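/- arXiv:2605.11676 — 2 statements merged into one kernel-verified Lean document; each statement's English description precedes it below -/
import Mathlib

section
/- Let K be a field with an absolute value ‖·‖ and let f: ℙ^N_K → ℙ^N_K be an endomorphism given by homogeneous polynomials F_0,…,F_N of degree d over K with no common zero over an algebraic closure of K other than the origin. Let P ∈ ℙ^N(K), and fix indices i and j such that the i-th homogeneous coordinate of P and the j-th homogeneous coordinate of f(P) are nonzero. Then there exists a constant c ≥ 0 such that λ_P^i(x) ≤ λ_{f(P)}^j(f(x)) + c for every x ∈ ℙ^N(K) (an inequality in [0, +∞]). -/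
open MvPolynomial
open scoped ENNReal NNReal

namespace Weil

variable {K : Type*} [Field K]

/-- `log⁺ t = max (0, log t)`. -/
noncomputable def logPlus (t : ℝ) : ℝ := Real.log (max 1 t)

/-- An absolute value, bundled into `ℝ≥0`. -/
noncomputable def nnabs (v : AbsoluteValue K ℝ) (t : K) : NNReal := ⟨v t, v.nonneg t⟩

/-- The Weil function `λ_P^i` of the point `P = [a_0, …, a_n] ∈ P^(n-1)(K)` (with `a i ≠ 0`),
evaluated at the point with homogeneous coordinates `x`:
`λ_P^i(x) = -log⁻ max_{j ≠ i} ‖x_j/x_i - a_j/a_i‖` if `x i ≠ 0`, and `0` otherwise.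
It takes the value `⊤ = +∞` exactly when `x = P`. -/
noncomputable def weil {n : ℕ} (v : AbsoluteValue K ℝ) (a x : Fin n → K) (i : Fin n) : ℝ≥0∞ :=
  letI : DecidableEq K := Classical.decEq K
  letI : DecidableEq NNReal := Classical.decEq NNReal
  if x i = 0 then 0
  else
    if (Finset.univ.erase i).sup (fun j => nnabs v (x j / x i - a j / a i)) = 0 then ⊤
    else ENNReal.ofReal
      (- Real.log
        (((Finset.univ.erase i).sup fun j => nnabs v (x j / x i - a j / a i) : NNReal) : ℝ))

/-- The Weil function of the hyperplane at infinity, on affine points: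
`λ_{H_∞}(x) = log⁺ max_i ‖x_i‖`. -/
noncomputable def weilInf (v : AbsoluteValue K ℝ) {n : ℕ} (x : Fin n → K) : ℝ :=
  logPlus ((Finset.univ.sup fun i => nnabs v (x i) : NNReal) : ℝ)

end Weil

namespace Weil

/-- A polynomial is Lipschitz at a point `q`, uniformly on the unit polydisc around `q`. -/
lemma exists_eval_sub_le {K σ : Type*} [Field K] (v : AbsoluteValue K ℝ)
    (G : MvPolynomial σ K) (q : σ → K) :
    ∃ L : ℝ, 0 ≤ L ∧ ∀ (y : σ → K) (δ : ℝ), 0 ≤ δ → δ ≤ 1 → (∀ k, v (y k - q k) ≤ δ) →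
      v (eval y G - eval q G) ≤ L * δ := by
  induction G using MvPolynomial.induction_on with
  | C a => exact ⟨0, le_rfl, fun y δ _ _ _ => by simp⟩
  | add G H hG hH =>
    obtain ⟨L, hL, hG⟩ := hG
    obtain ⟨M, hM, hH⟩ := hH
    refine ⟨L + M, by positivity, fun y δ h0 h1 hy => ?_⟩
    have e : eval y (G + H) - eval q (G + H) =
        (eval y G - eval q G) + (eval y H - eval q H) := by
      simp only [map_add]; ring
    rw [e]
    linarith [v.add_le (eval y G - eval q G) (eval y H - eval q H), hG y δ h0 h1 hy,
      hH y δ h0 h1 hy]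
  | mul_X G k hG =>
    obtain ⟨L, hL, hG⟩ := hG
    have hq := v.nonneg (q k)
    have hGq := v.nonneg (eval q G)
    refine ⟨L * (v (q k) + 1) + v (eval q G), by positivity, fun y δ h0 h1 hy => ?_⟩
    have e : eval y (G * X k) - eval q (G * X k) =
        (eval y G - eval q G) * y k + eval q G * (y k - q k) := by
      simp only [map_mul, eval_X]; ring
    have hyk : v (y k) ≤ v (q k) + 1 := by
      have h := v.add_le (q k) (y k - q k)
      rw [add_sub_cancel] at h
      linarith [hy k]
    rw [e]
    calc v ((eval y G - eval q G) * y k + eval q G * (y k - q k))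
        ≤ v (eval y G - eval q G) * v (y k) + v (eval q G) * v (y k - q k) := by
          simpa only [v.map_mul] using
            v.add_le ((eval y G - eval q G) * y k) (eval q G * (y k - q k))
      _ ≤ (L * δ) * (v (q k) + 1) + v (eval q G) * δ := by
          gcongr
          · exact hG y δ h0 h1 hy
          · exact hy k
      _ = (L * (v (q k) + 1) + v (eval q G)) * δ := by ring

/-- A quotient of values `b / t` is close to `a / s` when `b` is close to `a`, `t` is close to `s`,
and `s ≠ 0`. -/
lemma abs_div_sub_div_le {K : Type*} [Field K] (v : AbsoluteValue K ℝ) {a b s t : K} {M η : ℝ}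
    (hs : s ≠ 0) (hb : v (b - a) ≤ η) (ht : v (t - s) ≤ η) (hη : η ≤ v s / 2) (ha : v a ≤ M) :
    t ≠ 0 ∧ v (b / t - a / s) ≤ 2 * (v s + M) / v s ^ 2 * η := by
  have hm : 0 < v s := v.pos hs
  have hη0 : 0 ≤ η := (v.nonneg _).trans hb
  have hM : 0 ≤ M := (v.nonneg _).trans ha
  have htm : v s / 2 ≤ v t := by
    have h' := v.add_le t (s - t)
    rw [add_sub_cancel, v.map_sub s t] at h'
    linarith
  have htpos : 0 < v t := by linarith
  have ht0 : t ≠ 0 := v.pos_iff.1 htpos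
  refine ⟨ht0, ?_⟩
  have e : b / t - a / s = ((b - a) * s + a * (s - t)) / (t * s) := by
    field_simp; ring
  rw [e, map_div₀, v.map_mul t]
  calc v ((b - a) * s + a * (s - t)) / (v t * v s)
      ≤ (η * v s + M * η) / (v s / 2 * v s) := by
        gcongr
        refine (v.add_le _ _).trans ?_
        rw [v.map_mul, v.map_mul, v.map_sub s t]
        gcongr
    _ = 2 * (v s + M) / v s ^ 2 * η := by field_simp

/-- The distance whose logarithm defines the Weil function. -/
noncomputable def chartDist {K : Type*} [Field K] {n : ℕ} (v : AbsoluteValue K ℝ)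
    (a x : Fin n → K) (i : Fin n) : NNReal :=
  (Finset.univ.erase i).sup fun j => nnabs v (x j / x i - a j / a i)

lemma abs_sub_le_chartDist {K : Type*} [Field K] {n : ℕ} (v : AbsoluteValue K ℝ)
    {a x : Fin n → K} {i : Fin n} (ha : a i ≠ 0) (hx : x i ≠ 0) (k : Fin n) :
    v (x k / x i - a k / a i) ≤ chartDist v a x i := by
  by_cases hk : k = i
  · subst hk
    simp [div_self ha, div_self hx]
  · exact NNReal.coe_le_coe.2 (Finset.le_sup (f := fun j => nnabs v (x j / x i - a j / a i))
      (Finset.mem_erase.2 ⟨hk, Finset.mem_univ k⟩))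

lemma chartDist_le {K : Type*} [Field K] {n : ℕ} (v : AbsoluteValue K ℝ)
    {a x : Fin n → K} {i : Fin n} {r : ℝ} (hr : 0 ≤ r)
    (h : ∀ k, v (x k / x i - a k / a i) ≤ r) : (chartDist v a x i : ℝ) ≤ r := by
  lift r to NNReal using hr
  exact NNReal.coe_le_coe.2 (Finset.sup_le fun k _ => NNReal.coe_le_coe.1 (h k))

lemma weil_of_eq_zero {K : Type*} [Field K] {n : ℕ} (v : AbsoluteValue K ℝ)
    {a x : Fin n → K} {i : Fin n} (hx : x i = 0) : weil v a x i = 0 := by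
  simp [weil, hx]

lemma weil_eq_top {K : Type*} [Field K] {n : ℕ} (v : AbsoluteValue K ℝ)
    {a x : Fin n → K} {i : Fin n} (hx : x i ≠ 0) (h : chartDist v a x i = 0) :
    weil v a x i = ⊤ := by
  unfold weil
  rw [if_neg hx]
  exact if_pos h

lemma weil_eq_ofReal {K : Type*} [Field K] {n : ℕ} (v : AbsoluteValue K ℝ)
    {a x : Fin n → K} {i : Fin n} (hx : x i ≠ 0) (h : chartDist v a x i ≠ 0) :
    weil v a x i = ENNReal.ofReal (-Real.log (chartDist v a x i)) := by
  unfold weil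
  rw [if_neg hx]
  exact if_neg h

/-- Comparison of Weil functions from a Lipschitz bound between the chart distances near a
point. -/
lemma weil_le_weil_add {K : Type*} [Field K] {n m : ℕ} (v : AbsoluteValue K ℝ)
    {a x : Fin n → K} {i : Fin n} {b y : Fin m → K} {j : Fin m} {ε C c : ℝ}
    (hε : 0 < ε) (hC : 0 < C) (hcε : -Real.log ε ≤ c) (hcC : Real.log C ≤ c)
    (h : x i ≠ 0 → (chartDist v a x i : ℝ) ≤ ε →
      y j ≠ 0 ∧ (chartDist v b y j : ℝ) ≤ C * chartDist v a x i) :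
    weil v a x i ≤ weil v b y j + ENNReal.ofReal c := by
  by_cases hx : x i = 0
  · simp [weil_of_eq_zero v hx]
  rcases le_or_gt (chartDist v a x i : ℝ) ε with hd | hd
  · obtain ⟨hy, hle⟩ := h hx hd
    by_cases hb : chartDist v b y j = 0
    · simp [weil_eq_top v hy hb]
    have hb' : (0 : ℝ) < chartDist v b y j := NNReal.coe_pos.2 (pos_iff_ne_zero.2 hb)
    have ha' : (0 : ℝ) < chartDist v a x i := pos_of_mul_pos_right (hb'.trans_le hle) hC.le
    have ha : chartDist v a x i ≠ 0 := (NNReal.coe_pos.1 ha').ne'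
    rw [weil_eq_ofReal v hx ha, weil_eq_ofReal v hy hb]
    refine le_trans (ENNReal.ofReal_le_ofReal ?_) ENNReal.ofReal_add_le
    have hlog := Real.log_le_log hb' hle
    rw [Real.log_mul hC.ne' ha'.ne'] at hlog
    linarith
  · have ha : chartDist v a x i ≠ 0 := (NNReal.coe_pos.1 (hε.trans hd)).ne'
    rw [weil_eq_ofReal v hx ha]
    refine le_trans (ENNReal.ofReal_le_ofReal ?_) le_add_self
    linarith [Real.log_le_log hε hd.le]

/-- A form of degree `d` at `x`, in terms of its value at the normalised point `x / x i`. -/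
lemma eval_eq_pow_mul_eval_div {K σ : Type*} [Field K] {d : ℕ} {G : MvPolynomial σ K}
    (hG : G.IsHomogeneous d) (x : σ → K) {i : σ} (hx : x i ≠ 0) :
    eval x G = x i ^ d * eval (fun k => x k / x i) G := by
  rw [eval_eq, eval_eq, Finset.mul_sum]
  refine Finset.sum_congr rfl fun s hs => ?_
  rw [hG.degree_eq_sum_deg_support hs, ← Finset.prod_pow_eq_pow_sum, mul_left_comm,
    ← Finset.prod_mul_distrib]
  congr 1
  refine Finset.prod_congr rfl fun k _ => ?_
  rw [← mul_pow, mul_div_cancel₀ _ hx]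

end Weil

open Weil in
/-- Let `f : P^N_K → P^N_K` be the endomorphism given by homogeneous
polynomials `F_0, …, F_N` of degree `d` with no nonzero common zero over the algebraic
closure.  Then `λ_P^i(x) ≤ λ_{f(P)}^j(f(x)) + c` for some constant `c ≥ 0` and all
`x ∈ P^N(K)`. -/
theorem statement11 {K : Type*} [Field K] (N d : ℕ) (v : AbsoluteValue K ℝ)
    (F : Fin (N + 1) → MvPolynomial (Fin (N + 1)) K)
    (hFhom : ∀ i, (F i).IsHomogeneous d)
    (hFelim : ∀ w : Fin (N + 1) → AlgebraicClosure K,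
      (∀ i, MvPolynomial.eval w
        (MvPolynomial.map (algebraMap K (AlgebraicClosure K)) (F i)) = 0) → w = 0)
    (p : Fin (N + 1) → K) (hp : p ≠ 0)
    (i j : Fin (N + 1)) (hpi : p i ≠ 0) (hpj : MvPolynomial.eval p (F j) ≠ 0) :
    ∃ c : ℝ, 0 ≤ c ∧ ∀ x : Fin (N + 1) → K, x ≠ 0 →
      weil v p x i ≤
        weil v (fun l => MvPolynomial.eval p (F l)) (fun l => MvPolynomial.eval x (F l)) j +
          ENNReal.ofReal c := by
  set q : Fin (N + 1) → K := fun k => p k / p i with hq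
  have hpq : ∀ l, eval p (F l) = p i ^ d * eval q (F l) := fun l =>
    eval_eq_pow_mul_eval_div (hFhom l) p hpi
  choose L hL0 hL using fun l => exists_eval_sub_le v (F l) q
  set B : ℝ := 1 + ∑ l, L l with hB
  set M : ℝ := ∑ l, v (eval q (F l)) with hM
  have hLB : ∀ l, L l ≤ B := fun l =>
    (Finset.single_le_sum (f := L) (fun k _ => hL0 k) (Finset.mem_univ l)).trans (by linarith)
  have hqM : ∀ l, v (eval q (F l)) ≤ M := fun l =>
    Finset.single_le_sum (f := fun l => v (eval q (F l))) (fun k _ => v.nonneg _)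
      (Finset.mem_univ l)
  have hB0 : 0 < B := by
    have := Finset.sum_nonneg fun l (_ : l ∈ Finset.univ) => hL0 l
    linarith
  have hqj : eval q (F j) ≠ 0 := fun h => hpj (by rw [hpq, h, mul_zero])
  have hm : 0 < v (eval q (F j)) := v.pos hqj
  have hM0 : 0 < M := hm.trans_le (hqM j)
  set m : ℝ := v (eval q (F j)) with hmdef
  set ε : ℝ := min 1 (m / 2 / B) with hε
  set C : ℝ := 2 * (m + M) / m ^ 2 * B with hC
  have hε0 : 0 < ε := lt_min one_pos (by positivity)
  have hC0 : 0 < C := by positivity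
  refine ⟨max 0 (max (-Real.log ε) (Real.log C)), le_max_left _ _, fun x _ => ?_⟩
  refine weil_le_weil_add v hε0 hC0 ((le_max_left _ _).trans (le_max_right _ _))
    ((le_max_right _ _).trans (le_max_right _ _)) fun hxi hd => ?_
  set δ : ℝ := (chartDist v p x i : ℝ) with hδ
  have hδ0 : 0 ≤ δ := NNReal.coe_nonneg _
  set y : Fin (N + 1) → K := fun k => x k / x i with hy
  have hxy : ∀ l, eval x (F l) = x i ^ d * eval y (F l) := fun l =>
    eval_eq_pow_mul_eval_div (hFhom l) x hxi
  have hlip : ∀ l, v (eval y (F l) - eval q (F l)) ≤ B * δ := fun l =>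
    (hL l y δ hδ0 (hd.trans (min_le_left _ _))
      (abs_sub_le_chartDist v hpi hxi)).trans (mul_le_mul_of_nonneg_right (hLB l) hδ0)
  have hη : B * δ ≤ m / 2 := by
    rw [mul_comm]
    exact (le_div_iff₀ hB0).1 (hd.trans (min_le_right _ _))
  have key := fun l => abs_div_sub_div_le v hqj (hlip l) (hlip j) hη (hqM l)
  have hxd : x i ^ d ≠ 0 := pow_ne_zero d hxi
  have hpd : p i ^ d ≠ 0 := pow_ne_zero d hpi
  refine ⟨?_, chartDist_le v (by positivity) fun l => ?_⟩
  · simpa only [hxy] using mul_ne_zero hxd (key j).1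
  · simp only [hxy, hpq, mul_div_mul_left _ _ hxd, mul_div_mul_left _ _ hpd]
    rw [hC, mul_assoc]
    exact (key l).2
end

section
/- Let K be a field with an absolute value ‖·‖. Let t ≥ 1, let b_1,…,b_t ∈ K be pairwise distinct, let m_1,…,m_t ≥ 1 be integers, and let h ∈ K[x_1,x_2] be a polynomial of degree < m_1+⋯+m_t. Set g(x_1,x_2) = ∏_{j=1}^{t}(x_2 − b_j x_1)^{m_j} + h(x_1,x_2), M = max_j m_j, and c = l(h) + log⁺N(h). Then for every (x_1,x_2) ∈ K² with g(x_1,x_2) = 0 and ‖x_2‖ ≤ ‖x_1‖, one has log⁺‖x_1‖ ≤ M·Σ_{j=1}^{t} λ_{P_j}^1([1,x_1,x_2]) + c, where P_j = [0,1,b_j] ∈ ℙ²(K). -/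
open MvPolynomial
open scoped ENNReal NNReal

namespace Weil

variable {K : Type*} [Field K]

lemma logPlus_nonneg (t : ℝ) : 0 ≤ logPlus t := Real.log_nonneg (le_max_left _ _)

lemma le_exp_logPlus (t : ℝ) : t ≤ Real.exp (logPlus t) := by
  rw [logPlus, Real.exp_log (lt_of_lt_of_le one_pos (le_max_left _ _))]
  exact le_max_right _ _

/-- A polynomial of total degree at most `d`, evaluated at a point whose coordinates are bounded
by `R ≥ 1`, is bounded by `exp (l(h) + log⁺ N(h)) * R ^ d`. -/
lemma abv_eval_le {σ : Type*} (v : AbsoluteValue K ℝ) (h : MvPolynomial σ K) {d : ℕ}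
    (hd : h.totalDegree ≤ d) {R : ℝ} (hR : 1 ≤ R) (x : σ → K) (hx : ∀ i, v (x i) ≤ R) :
    v (MvPolynomial.eval x h) ≤
      Real.exp ((∑ μ ∈ h.support, logPlus (v (h.coeff μ))) + logPlus (h.support.card : ℝ)) *
        R ^ d := by
  set l := ∑ μ ∈ h.support, logPlus (v (h.coeff μ)) with hl
  have key : ∀ μ ∈ h.support,
      v (h.coeff μ * ∏ i ∈ μ.support, x i ^ μ i) ≤ Real.exp l * R ^ d := by
    intro μ hμ
    rw [map_mul, map_prod]
    refine mul_le_mul ?_ ?_ (Finset.prod_nonneg fun _ _ => v.nonneg _) (Real.exp_pos _).le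
    · refine (le_exp_logPlus _).trans (Real.exp_le_exp.2 ?_)
      exact Finset.single_le_sum (f := fun μ => logPlus (v (h.coeff μ)))
        (fun _ _ => logPlus_nonneg _) hμ
    · calc ∏ i ∈ μ.support, v (x i ^ μ i) ≤ ∏ i ∈ μ.support, R ^ μ i := by
            refine Finset.prod_le_prod (fun _ _ => v.nonneg _) fun i _ => ?_
            rw [map_pow]
            exact pow_le_pow_left₀ (v.nonneg _) (hx i) _
        _ = R ^ (∑ i ∈ μ.support, μ i) := Finset.prod_pow_eq_pow_sum _ _ _
        _ ≤ R ^ d := pow_le_pow_right₀ hR ((MvPolynomial.le_totalDegree hμ).trans hd)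
  rw [MvPolynomial.eval_eq]
  calc v (∑ μ ∈ h.support, h.coeff μ * ∏ i ∈ μ.support, x i ^ μ i)
      ≤ ∑ μ ∈ h.support, v (h.coeff μ * ∏ i ∈ μ.support, x i ^ μ i) := v.sum_le _ _
    _ ≤ h.support.card • (Real.exp l * R ^ d) := Finset.sum_le_card_nsmul _ _ _ key
    _ = h.support.card * (Real.exp l * R ^ d) := nsmul_eq_mul _ _
    _ ≤ Real.exp (logPlus (h.support.card : ℝ)) * (Real.exp l * R ^ d) :=
        mul_le_mul_of_nonneg_right (le_exp_logPlus _) (by positivity)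
    _ = Real.exp (l + logPlus (h.support.card : ℝ)) * R ^ d := by
        rw [Real.exp_add]; ring

lemma weil_point_at_infinity (v : AbsoluteValue K ℝ) (b x y : K) (hx : x ≠ 0) :
    weil v ![0, 1, b] ![1, x, y] 1 =
      ENNReal.ofReal (-Real.log (max (v x)⁻¹ (v (y / x - b)))) := by
  classical
  have hsup : ((Finset.univ.erase (1 : Fin 3)).sup fun j =>
      nnabs v ((![1, x, y] : Fin 3 → K) j / (![1, x, y] : Fin 3 → K) 1 -
        (![0, 1, b] : Fin 3 → K) j / (![0, 1, b] : Fin 3 → K) 1)) =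
      max (nnabs v x⁻¹) (nnabs v (y / x - b)) := by
    have : (Finset.univ.erase (1 : Fin 3)) = {0, 2} := by decide
    rw [this, Finset.sup_insert, Finset.sup_singleton]
    simp
  have hpos : max (nnabs v x⁻¹) (nnabs v (y / x - b)) ≠ 0 := by
    refine (lt_max_of_lt_left ?_).ne'
    exact v.pos (inv_ne_zero hx)
  have hcoe : ((max (nnabs v x⁻¹) (nnabs v (y / x - b)) : NNReal) : ℝ) =
      max (v x)⁻¹ (v (y / x - b)) := by
    rw [NNReal.coe_max, ← map_inv₀ v]
    rfl
  rw [weil, if_neg (by simpa using hx)]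
  rw [← hcoe, ← hsup, if_neg]
  exact fun h0 => hpos (hsup.symm.trans h0)

/-- If `∏ u_j ^ m_j ≤ exp c / r`, then `log r` is at most `c` plus a multiple of the sum of the
truncated logarithms of `1 / u_j`. -/
lemma log_le_of_prod_pow_le {t M : ℕ} (m : Fin t → ℕ) (hm : ∀ j, 1 ≤ m j) (hM : ∀ j, m j ≤ M)
    (u : Fin t → ℝ) {r c : ℝ} (hr : 1 < r) (hc : 0 ≤ c)
    (hprod : ∏ j, u j ^ m j ≤ Real.exp c / r) :
    Real.log r ≤ M * (∑ j, max (-Real.log (max r⁻¹ (u j))) 0) + c := by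
  have hr0 : 0 < r := one_pos.trans hr
  by_cases hsmall : ∃ j, u j ≤ r⁻¹
  · obtain ⟨j, hj⟩ := hsmall
    have h1 : Real.log r ≤ ∑ j, max (-Real.log (max r⁻¹ (u j))) 0 := by
      refine le_trans ?_ (Finset.single_le_sum
        (f := fun j => max (-Real.log (max r⁻¹ (u j))) 0)
        (fun _ _ => le_max_right _ _) (Finset.mem_univ j))
      simp only [max_eq_left hj, Real.log_inv, neg_neg]
      exact le_max_left _ _
    have hM1 : (1 : ℝ) ≤ M := by exact_mod_cast (hm j).trans (hM j)
    nlinarith [Real.log_pos hr]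
  · push Not at hsmall
    have hu : ∀ j, 0 < u j := fun j => (inv_pos.2 hr0).trans (hsmall j)
    have hlog : ∑ j, (m j : ℝ) * Real.log (u j) ≤ c - Real.log r := by
      have := Real.log_le_log (Finset.prod_pos fun j _ => pow_pos (hu j) (m j)) hprod
      rw [Real.log_prod fun j _ => (pow_pos (hu j) _).ne',
        Real.log_div (Real.exp_pos _).ne' hr0.ne', Real.log_exp] at this
      simpa only [Real.log_pow] using this
    have hsum : -∑ j, (m j : ℝ) * Real.log (u j) ≤
        M * ∑ j, max (-Real.log (max r⁻¹ (u j))) 0 := by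
      rw [← Finset.sum_neg_distrib, Finset.mul_sum]
      refine Finset.sum_le_sum fun j _ => ?_
      rw [max_eq_right (hsmall j).le]
      calc -((m j : ℝ) * Real.log (u j)) = m j * -Real.log (u j) := by ring
        _ ≤ m j * max (-Real.log (u j)) 0 :=
            mul_le_mul_of_nonneg_left (le_max_left _ _) (Nat.cast_nonneg _)
        _ ≤ M * max (-Real.log (u j)) 0 :=
            mul_le_mul_of_nonneg_right (Nat.cast_le.2 (hM j)) (le_max_right _ _)
    linarith

end Weil

open Weil in
/-- Let `b_1, …, b_t ∈ K` be pairwise distinct, `m_j ≥ 1`,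
`h ∈ K[x₁,x₂]` of degree `< Σ m_j`, and `g = Π (x₂ - b_j x₁)^{m_j} + h`.  Set
`M = max_j m_j` and `c = l(h) + log⁺ N(h)`.  Then every zero `(x₁,x₂)` of `g` with
`‖x₂‖ ≤ ‖x₁‖` satisfies `log⁺‖x₁‖ ≤ M Σ_j λ_{P_j}^1([1,x₁,x₂]) + c`, where
`P_j = [0,1,b_j]`.  -/
theorem statement15 {K : Type*} [Field K] (t : ℕ) (ht : 1 ≤ t) (v : AbsoluteValue K ℝ)
    (b : Fin t → K) (hb : Function.Injective b)
    (m : Fin t → ℕ) (hm : ∀ j, 1 ≤ m j)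
    (h : MvPolynomial (Fin 2) K) (hdeg : h.totalDegree < ∑ j, m j) :
    ∀ x₁ x₂ : K,
      MvPolynomial.eval ![x₁, x₂]
        ((∏ j, (MvPolynomial.X 1 - MvPolynomial.C (b j) * MvPolynomial.X 0) ^ m j) + h) = 0 →
      v x₂ ≤ v x₁ →
      ENNReal.ofReal (logPlus (v x₁)) ≤
        ((Finset.univ.sup m : ℕ) : ℝ≥0∞) * (∑ j, weil v ![0, 1, b j] ![1, x₁, x₂] 1) +
          ENNReal.ofReal
            ((∑ μ ∈ h.support, logPlus (v (h.coeff μ))) + logPlus (h.support.card : ℝ)) := by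
  intro x₁ x₂ hg hx
  set c := (∑ μ ∈ h.support, logPlus (v (h.coeff μ))) + logPlus (h.support.card : ℝ) with hc
  have hc0 : 0 ≤ c := add_nonneg (Finset.sum_nonneg fun _ _ => logPlus_nonneg _) (logPlus_nonneg _)
  rcases le_or_gt (v x₁) 1 with h1 | h1
  · simp [logPlus, max_eq_left h1]
  have hpos : 0 < v x₁ := one_pos.trans h1
  have hx₁ : x₁ ≠ 0 := v.pos_iff.1 hpos
  have hprod : ∏ j, v (x₂ / x₁ - b j) ^ m j ≤ Real.exp c / v x₁ := by
    have hh : v (MvPolynomial.eval ![x₁, x₂] h) ≤ Real.exp c * v x₁ ^ (∑ j, m j - 1) := by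
      refine abv_eval_le v h (Nat.le_sub_one_of_lt hdeg) h1.le _ fun i => ?_
      fin_cases i
      · exact le_rfl
      · exact hx
    have heval : v (MvPolynomial.eval ![x₁, x₂] h) =
        v x₁ ^ (∑ j, m j) * ∏ j, v (x₂ / x₁ - b j) ^ m j := by
      rw [map_add, add_comm] at hg
      rw [eq_neg_of_add_eq_zero_left hg, map_neg_eq_map, map_prod, map_prod,
        ← Finset.prod_pow_eq_pow_sum, ← Finset.prod_mul_distrib]
      refine Finset.prod_congr rfl fun j _ => ?_
      rw [← mul_pow, ← map_mul, mul_sub, mul_div_cancel₀ _ hx₁, map_pow, map_pow]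
      simp [mul_comm]
    have hD : ∑ j, m j = (∑ j, m j - 1) + 1 := by omega
    rw [le_div_iff₀ hpos]
    rw [heval] at hh
    nth_rewrite 1 [hD] at hh
    refine le_of_mul_le_mul_left ?_ (pow_pos hpos (∑ j, m j - 1))
    calc _ = _ := by ring
      _ ≤ _ := hh
      _ = _ := mul_comm _ _
  have hmain := log_le_of_prod_pow_le m hm (fun j => Finset.le_sup (Finset.mem_univ j))
    _ h1 hc0 hprod
  rw [logPlus, max_eq_right h1.le]
  refine (ENNReal.ofReal_le_ofReal hmain).trans ?_
  have hnonneg : ∀ j ∈ Finset.univ,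
      0 ≤ max (-Real.log (max (v x₁)⁻¹ (v (x₂ / x₁ - b j)))) 0 := fun _ _ => le_max_right _ _
  rw [ENNReal.ofReal_add (mul_nonneg (Nat.cast_nonneg _) (Finset.sum_nonneg hnonneg)) hc0,
    ENNReal.ofReal_mul (Nat.cast_nonneg _), ENNReal.ofReal_natCast,
    ENNReal.ofReal_sum_of_nonneg hnonneg]
  simp only [weil_point_at_infinity v _ x₁ x₂ hx₁, ENNReal.ofReal_max, ENNReal.ofReal_zero,
    max_eq_left (zero_le (α := ℝ≥0∞))]
  exact le_rfl
end
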